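/- The assignment F sending an object (g1: G1 → G0) of Mon(ω,𝒢) to the pair (g1: G1 → G0, g0: G0 → G1), where g0 is the unique S-linear map with g1∘g0 = ω·id_{G0} and g0∘g1 = ω·id_{G1}, and sending a morphism (φ1,φ0) to the same pair of maps, is a well-defined functor F: Mon(ω,𝒢) → MF(ω,𝒢) which is an equivalence of categories. -/

import Mathlib

open CategoryTheory LinearMap Function

/-- A module `M` over a commutative ring `A` is *Gorenstein projective* if the biduality
map `M → Hom_A(Hom_A(M,A),A)` is an isomorphism and
`Ext^i_A(M,A) = 0 = Ext^i_A(Hom_A(M,A),A)` for all `i ≥ 1`. -/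
noncomputable def IsGP (A : Type) [CommRing A] (M : Type) [AddCommGroup M] [Module A M] : Prop :=
  Function.Bijective (Module.Dual.eval A M) ∧
  (∀ i : ℕ, 0 < i →
    Subsingleton (((Ext A (ModuleCat A) i).obj
      (Opposite.op (ModuleCat.of A M))).obj (ModuleCat.of A A))) ∧
  (∀ i : ℕ, 0 < i →
    Subsingleton (((Ext A (ModuleCat A) i).obj
      (Opposite.op (ModuleCat.of A (Module.Dual A M)))).obj (ModuleCat.of A A)))

/-- `f : G1 → G0` is an object of the monomorphism category `Mon(ω, 𝒢)`:
`G1`, `G0` are finitely generated Gorenstein projective `S`-modules, `f` is injective,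
and `ω · Coker f = 0` (i.e. `ω • y ∈ range f` for all `y`). -/
def MonObj (S : Type) [CommRing S] (ω : S) {G1 G0 : Type}
    [AddCommGroup G1] [Module S G1] [AddCommGroup G0] [Module S G0]
    (f : G1 →ₗ[S] G0) : Prop :=
  Module.Finite S G1 ∧ Module.Finite S G0 ∧ IsGP S G1 ∧ IsGP S G0 ∧
  Function.Injective f ∧ ∀ y : G0, ω • y ∈ LinearMap.range f

/-- The monomorphism category `Mon(ω, 𝒢)` as a category: objects. -/
structure MonCatObj (S : Type) [CommRing S] (ω : S) : Type 1 where
  G1 : ModuleCat.{0} S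
  G0 : ModuleCat.{0} S
  f : G1 →ₗ[S] G0
  fin1 : Module.Finite S G1
  fin0 : Module.Finite S G0
  gp1 : IsGP S G1
  gp0 : IsGP S G0
  inj : Function.Injective f
  coker : ∀ y : G0, ω • y ∈ LinearMap.range f

/-- Morphisms of `Mon(ω, 𝒢)`: commutative squares. -/
@[ext]
structure MonCatHom {S : Type} [CommRing S] {ω : S} (X Y : MonCatObj S ω) : Type where
  φ1 : X.G1 →ₗ[S] Y.G1
  φ0 : X.G0 →ₗ[S] Y.G0
  comm : Y.f ∘ₗ φ1 = φ0 ∘ₗ X.f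

instance (S : Type) [CommRing S] (ω : S) : Category (MonCatObj S ω) where
  Hom := MonCatHom
  id X := ⟨LinearMap.id, LinearMap.id, by simp⟩
  comp {X Y Z} u v := ⟨v.φ1 ∘ₗ u.φ1, v.φ0 ∘ₗ u.φ0, by
    rw [← LinearMap.comp_assoc, v.comm, LinearMap.comp_assoc, u.comm,
      LinearMap.comp_assoc]⟩
  id_comp u := by apply MonCatHom.ext <;> simp
  comp_id u := by apply MonCatHom.ext <;> simp
  assoc u v w := by apply MonCatHom.ext <;> simp [LinearMap.comp_assoc]

/-- The category `MF(ω, 𝒢)` of matrix factorizations of Gorenstein projective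
modules: objects. -/
structure MFCatObj (S : Type) [CommRing S] (ω : S) : Type 1 where
  G1 : ModuleCat.{0} S
  G0 : ModuleCat.{0} S
  f : G1 →ₗ[S] G0
  g : G0 →ₗ[S] G1
  fin1 : Module.Finite S G1
  fin0 : Module.Finite S G0
  gp1 : IsGP S G1
  gp0 : IsGP S G0
  eq1 : f ∘ₗ g = ω • (LinearMap.id : G0 →ₗ[S] G0)
  eq2 : g ∘ₗ f = ω • (LinearMap.id : G1 →ₗ[S] G1)

/-- Morphisms of `MF(ω, 𝒢)`: pairs of maps commuting with both structure maps. -/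
@[ext]
structure MFCatHom {S : Type} [CommRing S] {ω : S} (X Y : MFCatObj S ω) : Type where
  φ1 : X.G1 →ₗ[S] Y.G1
  φ0 : X.G0 →ₗ[S] Y.G0
  comm1 : Y.f ∘ₗ φ1 = φ0 ∘ₗ X.f
  comm2 : Y.g ∘ₗ φ0 = φ1 ∘ₗ X.g

instance (S : Type) [CommRing S] (ω : S) : Category (MFCatObj S ω) where
  Hom := MFCatHom
  id X := ⟨LinearMap.id, LinearMap.id, by simp, by simp⟩
  comp {X Y Z} u v := ⟨v.φ1 ∘ₗ u.φ1, v.φ0 ∘ₗ u.φ0,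
    by rw [← LinearMap.comp_assoc, v.comm1, LinearMap.comp_assoc, u.comm1,
      LinearMap.comp_assoc],
    by rw [← LinearMap.comp_assoc, v.comm2, LinearMap.comp_assoc, u.comm2,
      LinearMap.comp_assoc]⟩
  id_comp u := by apply MFCatHom.ext <;> simp
  comp_id u := by apply MFCatHom.ext <;> simp
  assoc u v w := by apply MFCatHom.ext <;> simp [LinearMap.comp_assoc]

/-- The unique `g0` with `f (g0 y) = ω • y`. -/
noncomputable def monG {S : Type} [CommRing S] {ω : S} (X : MonCatObj S ω) :
    X.G0 →ₗ[S] X.G1 :=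
  (LinearEquiv.ofInjective X.f X.inj).symm.toLinearMap ∘ₗ
    LinearMap.codRestrict (LinearMap.range X.f) (ω • (LinearMap.id : X.G0 →ₗ[S] X.G0))
      (fun y => by simpa using X.coker y)

theorem f_monG {S : Type} [CommRing S] {ω : S} (X : MonCatObj S ω) (y : X.G0) :
    X.f (monG X y) = ω • y := by
  have h := LinearEquiv.apply_symm_apply (LinearEquiv.ofInjective X.f X.inj)
    (LinearMap.codRestrict (LinearMap.range X.f) (ω • (LinearMap.id : X.G0 →ₗ[S] X.G0))
      (fun y => by simpa using X.coker y) y)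
  exact congrArg Subtype.val h

theorem monG_comm {S : Type} [CommRing S] {ω : S} {X Y : MonCatObj S ω} (u : X ⟶ Y)
    (y : X.G0) : monG Y (u.φ0 y) = u.φ1 (monG X y) := by
  apply Y.inj
  have h := LinearMap.congr_fun u.comm (monG X y)
  simp only [LinearMap.comp_apply] at h
  rw [h, f_monG, f_monG, map_smul]

/-- The functor on objects. -/
noncomputable def monToMFObj {S : Type} [CommRing S] {ω : S} (X : MonCatObj S ω) :
    MFCatObj S ω where
  G1 := X.G1
  G0 := X.G0
  f := X.f
  g := monG X
  fin1 := X.fin1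
  fin0 := X.fin0
  gp1 := X.gp1
  gp0 := X.gp0
  eq1 := by
    ext y
    exact f_monG X y
  eq2 := by
    ext y
    apply X.inj
    simp [f_monG]

/-- The functor. -/
noncomputable def monToMF (S : Type) [CommRing S] (ω : S) :
    MonCatObj S ω ⥤ MFCatObj S ω where
  obj X := monToMFObj X
  map {X Y} u := MFCatHom.mk (X := monToMFObj X) (Y := monToMFObj Y) u.φ1 u.φ0 u.comm (by
    exact LinearMap.ext (monG_comm u))
  map_id X := rfl
  map_comp u v := rfl

theorem gp_smul_inj {S : Type} [CommRing S] {ω : S} (hreg : ω ∈ nonZeroDivisors S)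
    (M : Type) [AddCommGroup M] [Module S M] (h : IsGP S M) (x y : M)
    (hxy : ω • x = ω • y) : x = y := by
  apply h.1.1
  ext φ
  have h2 := congrArg φ hxy
  simp only [map_smul, smul_eq_mul] at h2
  exact (mul_cancel_left_mem_nonZeroDivisors hreg).1 h2

/-- The preimage of a matrix factorization. -/
def mfToMonObj {S : Type} [CommRing S] {ω : S} (hreg : ω ∈ nonZeroDivisors S)
    (Y : MFCatObj S ω) : MonCatObj S ω where
  G1 := Y.G1
  G0 := Y.G0
  f := Y.f
  fin1 := Y.fin1
  fin0 := Y.fin0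
  gp1 := Y.gp1
  gp0 := Y.gp0
  inj := by
    intro a b hab
    apply gp_smul_inj hreg _ Y.gp1
    have ha := LinearMap.congr_fun Y.eq2 a
    have hb := LinearMap.congr_fun Y.eq2 b
    simp only [LinearMap.comp_apply, LinearMap.smul_apply, LinearMap.id_apply] at ha hb
    rw [← ha, ← hb, hab]
  coker y := ⟨Y.g y, LinearMap.congr_fun Y.eq1 y⟩

theorem monToMFObj_mfToMonObj {S : Type} [CommRing S] {ω : S} (hreg : ω ∈ nonZeroDivisors S)
    (Y : MFCatObj S ω) : monToMFObj (mfToMonObj hreg Y) = Y := by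
  have hg : monG (mfToMonObj hreg Y) = Y.g := by
    ext y
    apply (mfToMonObj hreg Y).inj
    rw [f_monG]
    exact (LinearMap.congr_fun Y.eq1 y).symm
  cases Y
  simp only [monToMFObj, hg]
  rfl

/-- the assignment sending `(g1 : G1 → G0) ∈ Mon(ω, 𝒢)` to the matrix
factorization `(g1 : G1 → G0, g0 : G0 → G1)` (where `g0` is the unique map with
`g1 ∘ g0 = ω • id` and `g0 ∘ g1 = ω • id`) and keeping morphisms unchanged is a
well-defined functor `F : Mon(ω, 𝒢) → MF(ω, 𝒢)` which is an equivalence. -/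
theorem stmt_10 (S : Type) [CommRing S] [IsNoetherianRing S] [IsLocalRing S]
    (ω : S) (hω : ω ∈ IsLocalRing.maximalIdeal S) (hreg : ω ∈ nonZeroDivisors S) :
    ∃ F : MonCatObj S ω ⥤ MFCatObj S ω,
      F.IsEquivalence ∧
      (∀ X : MonCatObj S ω,
        (F.obj X).G1 = X.G1 ∧ (F.obj X).G0 = X.G0 ∧ HEq (F.obj X).f X.f) ∧
      (∀ (X Y : MonCatObj S ω) (u : X ⟶ Y),
        HEq (F.map u).φ1 u.φ1 ∧ HEq (F.map u).φ0 u.φ0) := by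
  refine ⟨monToMF S ω, ?_, fun X => ⟨rfl, rfl, HEq.rfl⟩, fun X Y u => ⟨HEq.rfl, HEq.rfl⟩⟩
  have h1 : (monToMF S ω).Faithful := ⟨by
    intro X Y u v h
    exact MonCatHom.ext (congrArg MFCatHom.φ1 h) (congrArg MFCatHom.φ0 h)⟩
  have h2 : (monToMF S ω).Full := ⟨by
    intro X Y u
    exact ⟨MonCatHom.mk (X := X) (Y := Y) u.φ1 u.φ0 u.comm1, rfl⟩⟩
  have h3 : (monToMF S ω).EssSurj := ⟨fun Y =>
    ⟨mfToMonObj hreg Y, ⟨eqToIso (monToMFObj_mfToMonObj hreg Y)⟩⟩⟩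
  exact {}
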